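/- Under the projective Lelieuvre relations in asymptotic coordinates, if at a point p ∈ ℝ² one has det(ν,ν_x,ν_y,ν_{xy})(p) > 0 and ⟨f_x,ν_y⟩(p) > 0, then f(p) = [ν,ν_x,ν_y](p) / √(det(ν,ν_x,ν_y,ν_{xy})(p)). -/

import Mathlib

noncomputable section

/-- Euclidean pairing on `ℝ⁴`. -/
def dot4 (a b : Fin 4 → ℝ) : ℝ := ∑ i, a i * b i

/-- Determinant of the 4×4 matrix with rows `a, b, c, d`. -/
def det4 (a b c d : Fin 4 → ℝ) : ℝ := Matrix.det (Matrix.of ![a, b, c, d])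

/-- Partial derivative in the first (`x`) variable. -/
def dx (g : ℝ × ℝ → Fin 4 → ℝ) : ℝ × ℝ → Fin 4 → ℝ := fun p => fderiv ℝ g p (1, 0)

/-- Partial derivative in the second (`y`) variable. -/
def dy (g : ℝ × ℝ → Fin 4 → ℝ) : ℝ × ℝ → Fin 4 → ℝ := fun p => fderiv ℝ g p (0, 1)

lemma dot4_comm (a b : Fin 4 → ℝ) : dot4 a b = dot4 b a := by
  simp only [dot4, mul_comm]

lemma dot4_sub_smul (a b c : Fin 4 → ℝ) (t : ℝ) :
    dot4 a (b - t • c) = dot4 a b - t * dot4 a c := by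
  simp only [dot4, Fin.sum_univ_four, Pi.sub_apply, Pi.smul_apply, smul_eq_mul]
  ring

lemma dot4_self_ne_zero {a : Fin 4 → ℝ} (ha : a ≠ 0) : dot4 a a ≠ 0 :=
  fun h ↦ ha (dotProduct_self_eq_zero.mp h)

lemma det4_swap_fst_snd (a b c d : Fin 4 → ℝ) : det4 b a c d = -det4 a b c d := by
  simp [det4, Matrix.det_succ_row_zero, Fin.sum_univ_succ, Fin.succAbove]
  ring

lemma det4_swap_snd_trd (a b c d : Fin 4 → ℝ) : det4 a c b d = -det4 a b c d := by
  simp [det4, Matrix.det_succ_row_zero, Fin.sum_univ_succ, Fin.succAbove]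
  ring

lemma det4_swap_trd_fth (a b c d : Fin 4 → ℝ) : det4 a b d c = -det4 a b c d := by
  simp [det4, Matrix.det_succ_row_zero, Fin.sum_univ_succ, Fin.succAbove]
  ring

lemma det4_rotate (a b c d : Fin 4 → ℝ) : det4 d a b c = -det4 a b c d := by
  rw [det4_swap_fst_snd, det4_swap_snd_trd, det4_swap_trd_fth, neg_neg]

lemma det4_eq_zero_of_fst_eq_snd (a c d : Fin 4 → ℝ) : det4 a a c d = 0 := by
  linarith [det4_swap_fst_snd a a c d]

lemma det4_eq_zero_of_snd_eq_trd (a b d : Fin 4 → ℝ) : det4 a b b d = 0 := by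
  linarith [det4_swap_snd_trd a b b d]

lemma det4_eq_zero_of_fst_eq_trd (a b d : Fin 4 → ℝ) : det4 a b a d = 0 := by
  rw [det4_swap_snd_trd, det4_eq_zero_of_fst_eq_snd, neg_zero]

lemma det4_eq_zero_of_fst_eq_fth (a b c : Fin 4 → ℝ) : det4 a b c a = 0 := by
  rw [det4_swap_trd_fth, det4_eq_zero_of_fst_eq_trd, neg_zero]

lemma eq_zero_of_dot4_eq_zero {a b c d v : Fin 4 → ℝ} (hdet : det4 a b c d ≠ 0)
    (ha : dot4 a v = 0) (hb : dot4 b v = 0) (hc : dot4 c v = 0) (hd : dot4 d v = 0) :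
    v = 0 := by
  refine Matrix.eq_zero_of_mulVec_eq_zero hdet ?_
  funext i
  fin_cases i
  exacts [ha, hb, hc, hd]

/-- The product rule for two orthogonal vector fields. -/
lemma dot4_fderiv_add_eq_zero {g h : ℝ × ℝ → Fin 4 → ℝ} {p : ℝ × ℝ}
    (hg : DifferentiableAt ℝ g p) (hh : DifferentiableAt ℝ h p)
    (horth : ∀ q, dot4 (g q) (h q) = 0) (v : ℝ × ℝ) :
    dot4 (fderiv ℝ g p v) (h p) + dot4 (g p) (fderiv ℝ h p v) = 0 := by
  have hderiv := HasFDerivAt.fun_sum (u := Finset.univ) fun i _ ↦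
    (hasFDerivAt_pi'.mp hg.hasFDerivAt i).mul (hasFDerivAt_pi'.mp hh.hasFDerivAt i)
  have hzero : (fun q ↦ ∑ i, g q i * h q i) = fun _ ↦ (0 : ℝ) := funext horth
  have := congrArg (fun L : ℝ × ℝ →L[ℝ] ℝ ↦ L v)
    (hderiv.unique (hzero ▸ hasFDerivAt_const (0 : ℝ) p))
  simp [Fin.sum_univ_four] at this
  simp only [dot4, Fin.sum_univ_four]
  linarith

/-- If `f` is orthogonal to `ν` and `f ∧ f' = t • ⋆(ν ∧ ν')` for derivatives `f'`, `ν'` in a common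
direction, then `f` is orthogonal to `ν'`. -/
lemma dot4_fderiv_eq_zero {f ν : ℝ × ℝ → Fin 4 → ℝ} {p : ℝ × ℝ} (hf : DifferentiableAt ℝ f p)
    (hν : DifferentiableAt ℝ ν p) (horth : ∀ q, dot4 (f q) (ν q) = 0) (hf0 : f p ≠ 0)
    (v : ℝ × ℝ) (t : ℝ)
    (hL : ∀ w z, dot4 w (f p) * dot4 z (fderiv ℝ f p v) - dot4 z (f p) * dot4 w (fderiv ℝ f p v)
      = t * det4 w z (ν p) (fderiv ℝ ν p v)) :
    dot4 (f p) (fderiv ℝ ν p v) = 0 := by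
  have hwedge := hL (f p) (ν p)
  rw [dot4_comm (ν p) (f p), horth p, det4_eq_zero_of_snd_eq_trd, zero_mul, sub_zero,
    mul_zero] at hwedge
  have hν' := (mul_eq_zero.mp hwedge).resolve_left (dot4_self_ne_zero hf0)
  have hprod := dot4_fderiv_add_eq_zero hf hν horth v
  rwa [dot4_comm, hν', zero_add] at hprod

theorem stmt2 (f ν : ℝ × ℝ → Fin 4 → ℝ)
    (hsf : ContDiff ℝ (⊤ : ℕ∞) f) (hsν : ContDiff ℝ (⊤ : ℕ∞) ν)
    (hpair : ∀ p, dot4 (f p) (ν p) = 0)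
    (hLx : ∀ p, ∀ w z : Fin 4 → ℝ,
      dot4 w (f p) * dot4 z (dx f p) - dot4 z (f p) * dot4 w (dx f p)
        = det4 w z (ν p) (dx ν p))
    (hLy : ∀ p, ∀ w z : Fin 4 → ℝ,
      dot4 w (f p) * dot4 z (dy f p) - dot4 z (f p) * dot4 w (dy f p)
        = - det4 w z (ν p) (dy ν p))
    (hf0 : ∀ p, f p ≠ 0)
    (tr : (Fin 4 → ℝ) → (Fin 4 → ℝ) → (Fin 4 → ℝ) → (Fin 4 → ℝ))
    (htr : ∀ w a b c : Fin 4 → ℝ, dot4 w (tr a b c) = det4 w a b c)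
    (p : ℝ × ℝ)
    (hdet : 0 < det4 (ν p) (dx ν p) (dy ν p) (dy (dx ν) p))
    (hpos : 0 < dot4 (dx f p) (dy ν p)) :
    f p = (Real.sqrt (det4 (ν p) (dx ν p) (dy ν p) (dy (dx ν) p)))⁻¹ •
      tr (ν p) (dx ν p) (dy ν p) := by
  have hfd : Differentiable ℝ f := hsf.differentiable (by simp)
  have hνd : Differentiable ℝ ν := hsν.differentiable (by simp)
  have hdxν : Differentiable ℝ (dx ν) :=
    ((hsν.fderiv_right (m := 1) (by norm_cast)).clm_apply contDiff_const).differentiable (by simp)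
  have hfνx : ∀ q, dot4 (f q) (dx ν q) = 0 := fun q ↦
    dot4_fderiv_eq_zero (hfd q) (hνd q) hpair (hf0 q) (1, 0) 1 fun w z ↦ by
      rw [one_mul]; exact hLx q w z
  have hfνy : dot4 (f p) (dy ν p) = 0 :=
    dot4_fderiv_eq_zero (hfd p) (hνd p) hpair (hf0 p) (0, 1) (-1) fun w z ↦ by
      rw [neg_one_mul]; exact hLy p w z
  have hνf : dot4 (ν p) (f p) = 0 := by rw [dot4_comm, hpair]
  have hνxf : dot4 (dx ν p) (f p) = 0 := by rw [dot4_comm, hfνx]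
  have hνyf : dot4 (dy ν p) (f p) = 0 := by rw [dot4_comm, hfνy]
  have hmixed : dot4 (dy f p) (dx ν p) + dot4 (f p) (dy (dx ν) p) = 0 :=
    dot4_fderiv_add_eq_zero (hfd p) (hdxν p) hfνx (0, 1)
  have hx := hLx p (dy (dx ν) p) (dy ν p)
  have hy := hLy p (dy (dx ν) p) (dx ν p)
  have hcycle := htr (dy (dx ν) p) (ν p) (dx ν p) (dy ν p)
  have hN₁ := htr (ν p) (ν p) (dx ν p) (dy ν p)
  have hN₂ := htr (dx ν p) (ν p) (dx ν p) (dy ν p)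
  have hN₃ := htr (dy ν p) (ν p) (dx ν p) (dy ν p)
  rw [det4_eq_zero_of_fst_eq_snd] at hN₁
  rw [det4_eq_zero_of_fst_eq_trd] at hN₂
  rw [det4_eq_zero_of_fst_eq_fth] at hN₃
  rw [hνyf, zero_mul, sub_zero, dot4_comm (dy ν p), det4_rotate, det4_swap_fst_snd,
    det4_swap_snd_trd, neg_neg] at hx
  rw [hνxf, zero_mul, sub_zero, dot4_comm (dx ν p), det4_rotate, det4_swap_fst_snd,
    neg_neg] at hy
  rw [det4_rotate] at hcycle
  rw [dot4_comm (f p)] at hmixed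
  set D := det4 (ν p) (dx ν p) (dy ν p) (dy (dx ν) p)
  set s := dot4 (dy (dx ν) p) (f p)
  have hs : s < 0 := by
    by_contra! hs
    nlinarith [mul_nonneg hs hpos.le]
  have hD : D = (-s) ^ 2 := by
    rw [eq_neg_of_add_eq_zero_left hmixed] at hy
    linarith
  have hsqrt : √D = -s := by rw [hD, Real.sqrt_sq (by linarith)]
  rw [← sub_eq_zero]
  refine eq_zero_of_dot4_eq_zero hdet.ne' ?_ ?_ ?_ ?_ <;> rw [dot4_sub_smul]
  · rw [hνf, hN₁, mul_zero, sub_zero]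
  · rw [hνxf, hN₂, mul_zero, sub_zero]
  · rw [hνyf, hN₃, mul_zero, sub_zero]
  · change s - _ = 0
    rw [hcycle, hsqrt, hD]
    field_simp [hs.ne]
    ring
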